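/- There exists a continuous function f : ℝP³ → ℝ whose homotopy significant spectrum is strictly larger than its Krasnoselskii spectrum; specifically, f(x) = dist(x, ℝP² # T) for a suitably embedded Dyck's surface has a homotopy significant eigenvalue r that is not a Krasnoselskii eigenvalue. -/

import Mathlib

open Set Metric Topology unitInterval

noncomputable section
open Classical

variable {B : Type*} [NormedAddCommGroup B] [NormedSpace ℝ B]

/-- There exists a continuous, odd, nonvanishing map `A → ℝ^m \ {0}`. -/
def HasOddMap (A : Set B) (m : ℕ) : Prop :=
  ∃ h : A → (Fin m → ℝ), Continuous h ∧ (∀ x, h x ≠ 0) ∧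
    ∀ (x : A) (hx : -(x : B) ∈ A), h ⟨-(x : B), hx⟩ = -h x

/-- Krasnoselskii genus. -/
def genus (A : Set B) : ℕ∞ :=
  if A = ∅ then 0 else sInf {m : ℕ∞ | ∃ k : ℕ, m = k ∧ HasOddMap A k}

/-- A set is contractible within the ambient space `Φ`. -/
def ContractibleIn {Φ : Type*} [TopologicalSpace Φ] (C : Set Φ) : Prop :=
  ∃ x₀ : Φ, ∃ H : C(↥C × ↥I, Φ),
    (∀ x : C, H (x, 0) = (x : Φ)) ∧ (∀ x : C, H (x, 1) = x₀)

/-- Lusternik–Schnirelmann subspace category (with closed covers). -/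
def catLS {Φ : Type*} [TopologicalSpace Φ] (A : Set Φ) : ℕ∞ :=
  sInf {m : ℕ∞ | ∃ k : ℕ, m = k ∧ ∃ C : Fin k → Set Φ,
    (∀ i, IsClosed (C i)) ∧ (∀ i, ContractibleIn (C i)) ∧ A ⊆ ⋃ i, C i}

/-- `X` can be brought to `Y` via a homotopy in `Φ` starting from the inclusion. -/
def BringsTo {Φ : Type*} [TopologicalSpace Φ] (X Y : Set Φ) : Prop :=
  ∃ H : C(↥X × ↥I, Φ),
    (∀ x : X, H (x, 0) = (x : Φ)) ∧ (∀ x : X, H (x, 1) ∈ Y)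

/-- `a` lies in the homotopy significant spectrum of `f`. -/
def HomotopySignificant {Φ : Type*} [TopologicalSpace Φ] (f : Φ → ℝ) (a : ℝ) : Prop :=
  ¬ BringsTo {x | f x ≤ a} {x | f x < a}

/-- `e` is a weak homotopy significant eigenvalue of `f`. -/
def WeakHomotopySignificant {Φ : Type*} [TopologicalSpace Φ] (f : Φ → ℝ) (e : ℝ) : Prop :=
  ∀ t₁ > e, ∀ t₂ < e, ¬ BringsTo {x | f x ≤ t₁} {x | f x ≤ t₂}

/-- The k-th Krasnoselskii eigenvalue of (the restriction to the unit sphere of) `f`. -/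
def kr (f : B → ℝ) (k : ℕ) : EReal :=
  ⨅ A ∈ {A : Set B | A ⊆ sphere (0 : B) 1 ∧ IsClosed A ∧ A = -A ∧ (k : ℕ∞) ≤ genus A},
    ⨆ x ∈ A, (f x : EReal)

/-- The k-th category (min-max) eigenvalue of `f`. -/
def hs {Φ : Type*} [TopologicalSpace Φ] (f : Φ → ℝ) (k : ℕ) : EReal :=
  ⨅ A ∈ {A : Set Φ | IsClosed A ∧ (k : ℕ∞) ≤ catLS A}, ⨆ x ∈ A, (f x : EReal)

/-- The antipodal setoid on the unit sphere of `B`. -/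
def projSetoid (B : Type*) [NormedAddCommGroup B] [NormedSpace ℝ B] :
    Setoid ↥(sphere (0 : B) 1) where
  r x y := (x : B) = y ∨ (x : B) = -(y : B)
  iseqv := by
    constructor
    · intro x; exact Or.inl rfl
    · rintro x y (h | h)
      · exact Or.inl h.symm
      · exact Or.inr (by rw [h, neg_neg])
    · rintro x y z (h | h) (h' | h')
      · exact Or.inl (h.trans h')
      · exact Or.inr (by rw [h, h'])
      · exact Or.inr (by rw [h, h'])
      · exact Or.inl (by rw [h, h', neg_neg])

/-- The projective space of `B`, as the quotient of the unit sphere by the antipodal map. -/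
def Proj (B : Type*) [NormedAddCommGroup B] [NormedSpace ℝ B] := Quotient (projSetoid B)

instance : TopologicalSpace (Proj B) := instTopologicalSpaceQuotient



lemma log_lift (V : ℝ × ℝ → ℂ) (hV : Continuous V) (h0 : ∀ x, V x ≠ 0) :
    ∃ u : ℝ × ℝ → ℂ, Continuous u ∧ ∀ x, Complex.exp (u x) = V x := by
  have cov := Complex.isCoveringMap_exp
  obtain ⟨F, ⟨-, hF⟩, -⟩ := cov.existsUnique_continuousMap_lifts
    (⟨fun x => ⟨V x, h0 x⟩, by fun_prop⟩ : C(ℝ × ℝ, {z : ℂ // z ≠ 0})) (0, 0)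
    (Complex.log (V (0, 0))) (by simp [Complex.exp_log (h0 _)])
  refine ⟨F, F.continuous, fun x => ?_⟩
  have := congr_fun hF x
  exact congrArg Subtype.val this

lemma exp_const {T : Type*} [TopologicalSpace T] [PreconnectedSpace T] (u : T → ℂ)
    (hu : Continuous u) (c : ℂ) (h : ∀ x, Complex.exp (u x) = c) (x y : T) : u x = u y := by
  refine Complex.isCoveringMap_exp.const_of_comp hu (fun a b => ?_) x y
  exact Subtype.ext ((h a).trans (h b).symm)

lemma bu_rect (V : ℝ × ℝ → ℂ) (hV : Continuous V) (h0 : ∀ x, V x ≠ 0)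
    (hodd : ∀ a b, V (-a, b + Real.pi) = - V (a, b))
    (hp : ∀ b, V (Real.pi / 2, b) = V (Real.pi / 2, 0)) : False := by
  obtain ⟨u, hu, hexp⟩ := log_lift V hV h0
  have hP : ∀ b, u (Real.pi / 2, b) = u (Real.pi / 2, 0) := fun b =>
    exp_const (fun b => u (Real.pi / 2, b)) (by fun_prop) (V (Real.pi / 2, 0))
      (fun b => by rw [hexp, hp]) b 0
  have hQ : ∀ b, u (-(Real.pi / 2), b) = u (-(Real.pi / 2), 0) := fun b =>
    exp_const (fun b => u (-(Real.pi / 2), b)) (by fun_prop) (- V (Real.pi / 2, 0))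
      (fun b => by
        have := hodd (Real.pi / 2) (b - Real.pi)
        rw [sub_add_cancel] at this
        rw [hexp, this, hp]) b 0
  have hc := exp_const (fun x : ℝ × ℝ => u (-x.1, x.2 + Real.pi) - u x) (by fun_prop) (-1)
    (fun x => by
      rw [Complex.exp_sub, hexp, hexp, hodd, Prod.mk.eta, neg_div, div_self (h0 x)])
  have h1 := hc (Real.pi / 2, 0) (-(Real.pi / 2), 0)
  have h2 : Complex.exp (u (-(Real.pi / 2), 0)) = - Complex.exp (u (Real.pi / 2, 0)) := by
    rw [hexp, hexp, ← hodd, ← hexp, ← hexp, hQ (0 + Real.pi)]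
  simp only [neg_neg] at h1
  rw [hP (0 + Real.pi), hQ (0 + Real.pi)] at h1
  have h3 : u (-(Real.pi / 2), 0) = u (Real.pi / 2, 0) := by linear_combination h1 / 2
  rw [h3] at h2
  exact Complex.exp_ne_zero _ (by linear_combination h2 / 2)

/-- The core obstruction. -/
lemma no_odd_rect (w z : ℝ × ℝ → ℂ) (hw : Continuous w) (hz : Continuous z)
    (hwodd : ∀ a b, w (-a, b + Real.pi) = - w (a, b))
    (hzodd : ∀ a b, z (-a, b + Real.pi) = - z (a, b))
    (hwp : ∀ b, w (Real.pi / 2, b) = w (Real.pi / 2, 0))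
    (hzp : ∀ b, z (Real.pi / 2, b) = z (Real.pi / 2, 0))
    (h0 : ∀ x, w x - z x ^ 2 ≠ 0) : False := by
  obtain ⟨A, hA, hexp⟩ := log_lift (fun x => w x - z x ^ 2) (by fun_prop) h0
  have hP : ∀ b, A (Real.pi / 2, b) = A (Real.pi / 2, 0) := fun b =>
    exp_const (fun b => A (Real.pi / 2, b)) (by fun_prop) _
      (fun b => by rw [hexp, hwp, hzp]) b 0
  have hQ : ∀ b, A (-(Real.pi / 2), b) = A (-(Real.pi / 2), 0) := fun b =>
    exp_const (fun b => A (-(Real.pi / 2), b)) (by fun_prop)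
      (- w (Real.pi / 2, 0) - z (Real.pi / 2, 0) ^ 2)
      (fun b => by
        have h1 := hwodd (Real.pi / 2) (b - Real.pi)
        have h2 := hzodd (Real.pi / 2) (b - Real.pi)
        rw [sub_add_cancel] at h1 h2
        rw [hexp, h1, h2, hwp, hzp]; ring) b 0
  have hper : ∀ a b, A (a, b + Real.pi + Real.pi) = A (a, b) := fun a b => by
    have hw2 : ∀ x : ℝ × ℝ, w (x.1, x.2 + Real.pi + Real.pi) = w x := fun x => by
      have := hwodd (-x.1) (x.2 + Real.pi)
      rw [neg_neg] at this
      rw [this, hwodd, neg_neg]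
    have hz2 : ∀ x : ℝ × ℝ, z (x.1, x.2 + Real.pi + Real.pi) = z x := fun x => by
      have := hzodd (-x.1) (x.2 + Real.pi)
      rw [neg_neg] at this
      rw [this, hzodd, neg_neg]
    have := exp_const (fun x : ℝ × ℝ => A (x.1, x.2 + Real.pi + Real.pi) - A x)
      (by fun_prop) 1 (fun x => by
        rw [Complex.exp_sub, hexp, hexp, hw2, hz2, div_self (h0 x)]) (a, b) (Real.pi / 2, 0)
    simp only [] at this
    rw [hP, sub_self] at this
    linear_combination this
  obtain ⟨c, hc⟩ : ∃ c : ℂ, c ^ 2 = -1 / 2 :=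
    ⟨Complex.I / (Real.sqrt 2 : ℝ), by
      rw [div_pow, Complex.I_sq, ← Complex.ofReal_pow, Real.sq_sqrt (by norm_num)]; norm_num⟩
  have hsq : ∀ x, Complex.exp (A x / 2) ^ 2 = w x - z x ^ 2 := fun x => by
    rw [← Complex.exp_nat_mul, ← hexp]; congr 1; push_cast; ring
  refine bu_rect (fun x => z x + c * (Complex.exp (A x / 2)
    - Complex.exp (A (-x.1, x.2 + Real.pi) / 2))) (by fun_prop) (fun x hx => ?_)
    (fun a b => ?_) (fun b => ?_)
  · have e1 := hsq x
    have e2 := hsq (-x.1, x.2 + Real.pi)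
    rw [hwodd, hzodd, Prod.mk.eta] at e2
    have : Complex.exp (A x / 2) * Complex.exp (A (-x.1, x.2 + Real.pi) / 2) = 0 := by
      set p := Complex.exp (A x / 2)
      set q := Complex.exp (A (-x.1, x.2 + Real.pi) / 2)
      linear_combination (-(z x) + c * (p - q)) * hx + (1/2) * e1 + (1/2) * e2 - (p - q)^2 * hc
    rcases mul_eq_zero.1 this with h | h <;> exact Complex.exp_ne_zero _ h
  · simp only [neg_neg]
    rw [hzodd, hper]; ring
  · simp only []
    rw [hzp, hP, hQ, hQ (0 + Real.pi)]

/-- No odd nonvanishing function on the Klein bottle. -/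
lemma no_odd_klein (h : ℝ × ℝ → ℂ) (hh : Continuous h) (h0 : ∀ x, h x ≠ 0)
    (hs : ∀ b, h (Real.pi / 2, b) = - h (-(Real.pi / 2), b))
    (hr : ∀ a, h (a, Real.pi) = - h (-a, 0)) : False := by
  obtain ⟨u, hu, hexp⟩ := log_lift h hh h0
  have h1 := exp_const (fun b : ℝ => u (Real.pi / 2, b) - u (-(Real.pi / 2), b)) (by fun_prop)
    (-1) (fun b => by rw [Complex.exp_sub, hexp, hexp, hs, neg_div, div_self (h0 _)]) 0 Real.pi
  have h2 := exp_const (fun a : ℝ => u (a, Real.pi) - u (-a, 0)) (by fun_prop)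
    (-1) (fun b => by rw [Complex.exp_sub, hexp, hexp, hr, neg_div, div_self (h0 _)])
    (Real.pi / 2) (-(Real.pi / 2))
  simp only [neg_neg] at h1 h2
  have h3 : u (Real.pi / 2, 0) = u (-(Real.pi / 2), 0) := by linear_combination (h1 + h2) / 2
  have h4 := hs 0
  rw [← hexp, ← hexp, h3] at h4
  exact Complex.exp_ne_zero _ (by linear_combination h4 / 2)

/-- First complex coordinate on `ℝ⁴ = ℂ²`. -/
def cz1 (x : EuclideanSpace ℝ (Fin 4)) : ℂ := (x 0 : ℂ) + (x 1 : ℂ) * Complex.I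

/-- Second complex coordinate on `ℝ⁴ = ℂ²`. -/
def cz2 (x : EuclideanSpace ℝ (Fin 4)) : ℂ := (x 2 : ℂ) + (x 3 : ℂ) * Complex.I

/-- The function on `ℝ⁴` whose restriction to the sphere descends to the example. -/
def fS (x : EuclideanSpace ℝ (Fin 4)) : ℝ :=
  -‖cz1 x ^ 2 - cz2 x ^ 4‖ + (1 / 2) * (3 / 5 * x 0 + 4 / 5 * x 2) ^ 2

lemma cz1_neg (x : EuclideanSpace ℝ (Fin 4)) : cz1 (-x) = - cz1 x := by
  simp [cz1]; ring

lemma cz2_neg (x : EuclideanSpace ℝ (Fin 4)) : cz2 (-x) = - cz2 x := by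
  simp [cz2]; ring

lemma continuous_cz1 : Continuous cz1 := by unfold cz1; fun_prop

lemma continuous_cz2 : Continuous cz2 := by unfold cz2; fun_prop

lemma continuous_fS : Continuous fS := by
  have := continuous_cz1
  have := continuous_cz2
  unfold fS; fun_prop

lemma fS_neg (x : EuclideanSpace ℝ (Fin 4)) : fS (-x) = fS x := by
  unfold fS
  rw [cz1_neg, cz2_neg]
  simp only [PiLp.neg_apply]
  congr 1
  · congr 2; ring
  · ring

lemma mem_sphere4 (x : EuclideanSpace ℝ (Fin 4)) :
    x ∈ sphere (0 : EuclideanSpace ℝ (Fin 4)) 1 ↔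
      x 0 ^ 2 + x 1 ^ 2 + x 2 ^ 2 + x 3 ^ 2 = 1 := by
  rw [mem_sphere_zero_iff_norm, EuclideanSpace.norm_eq, Real.sqrt_eq_one, Fin.sum_univ_four]
  simp

/-- The example function on projective space. -/
def fP : Proj (EuclideanSpace ℝ (Fin 4)) → ℝ :=
  Quotient.lift (s := projSetoid (EuclideanSpace ℝ (Fin 4)))
    (fun x : sphere (0 : EuclideanSpace ℝ (Fin 4)) 1 => fS x) (by
      rintro a b (h | h)
      · simp only [h]
      · simp only [h, fS_neg])

/-- The projection from the sphere. -/
def pr (x : sphere (0 : EuclideanSpace ℝ (Fin 4)) 1) : Proj (EuclideanSpace ℝ (Fin 4)) :=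
  Quotient.mk (projSetoid (EuclideanSpace ℝ (Fin 4))) x

lemma fP_pr (x : sphere (0 : EuclideanSpace ℝ (Fin 4)) 1) : fP (pr x) = fS x := rfl

lemma isQuotientMap_pr : IsQuotientMap pr := isQuotientMap_quotient_mk'

lemma continuous_fP : Continuous fP :=
  isQuotientMap_pr.continuous_iff.2 (continuous_fS.comp continuous_subtype_val)

lemma pr_eq_iff (x y : sphere (0 : EuclideanSpace ℝ (Fin 4)) 1) :
    pr x = pr y ↔ x = y ∨ x = -y := by
  have : pr x = pr y ↔ (projSetoid (EuclideanSpace ℝ (Fin 4))).r x y := Quotient.eq''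
  rw [this]
  simp only [projSetoid, Subtype.ext_iff]
  rfl

/-- The antipodal action. -/
@[reducible] def antip : MulAction ℤˣ (sphere (0 : EuclideanSpace ℝ (Fin 4)) 1) where
  smul g x := if g = 1 then x else -x
  one_smul x := if_pos rfl
  mul_smul g h x := by
    change (if g * h = 1 then x else -x) =
      if g = 1 then (if h = 1 then x else -x) else -(if h = 1 then x else -x)
    rcases Int.units_eq_one_or g with rfl | rfl <;> rcases Int.units_eq_one_or h with rfl | rfl <;>
      simp

lemma isCoveringMap_pr : IsCoveringMap pr := by
  letI := antip
  have hs : ∀ (g : ℤˣ) (x : sphere (0 : EuclideanSpace ℝ (Fin 4)) 1),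
    g • x = if g = 1 then x else -x := fun g x => rfl
  have : IsQuotientCoveringMap pr ℤˣ :=
    { isQuotientMap_pr with
      continuous_const_smul := by
        intro g
        simp only [hs]
        split_ifs
        · exact continuous_id
        · exact continuous_neg
      apply_eq_iff_mem_orbit := by
        intro x y
        rw [pr_eq_iff, MulAction.mem_orbit_iff]
        constructor
        · rintro (h | h)
          · exact ⟨1, by rw [h]; simp⟩
          · exact ⟨-1, by rw [h, hs]; simp⟩
        · rintro ⟨g, rfl⟩
          rcases Int.units_eq_one_or g with rfl | rfl
          · left; simp
          · right; rw [hs]; simp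
      disjoint := by
        intro e
        refine ⟨ball e 1, ball_mem_nhds _ one_pos, ?_⟩
        rintro g ⟨y, ⟨x, hx, rfl⟩, hy⟩
        rcases Int.units_eq_one_or g with rfl | rfl
        · rfl
        · exfalso
          simp only [hs] at hy
          rw [if_neg (by decide)] at hy
          have h1 : dist x (-x) < 2 := by
            have := dist_triangle_right x (-x) e
            rw [mem_ball] at hx hy
            linarith
          have h2 : dist x (-x) = 2 := by
            rw [Subtype.dist_eq, dist_eq_norm]
            have hx1 : ‖(x : EuclideanSpace ℝ (Fin 4))‖ = 1 := by simp
            have : (x : EuclideanSpace ℝ (Fin 4)) - ((-x : sphere (0 : EuclideanSpace ℝ (Fin 4)) 1) :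
              EuclideanSpace ℝ (Fin 4)) = (2 : ℝ) • (x : EuclideanSpace ℝ (Fin 4)) := by
              simp [two_smul]
            rw [this, norm_smul, hx1]; norm_num
          linarith }
  exact this.isCoveringMap

/-- Spherical coordinates on the two-sphere orthogonal to `(3/5, 0, 4/5, 0)`. -/
def sph (t : ℝ × ℝ) : EuclideanSpace ℝ (Fin 4) :=
  !₂[4 / 5 * Real.sin t.1, Real.cos t.1 * Real.cos t.2, -(3 / 5) * Real.sin t.1,
    Real.cos t.1 * Real.sin t.2]

lemma continuous_sph : Continuous sph := by
  unfold sph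
  refine (PiLp.continuous_toLp 2 _).comp (continuous_pi fun i => ?_)
  fin_cases i <;> simp <;> fun_prop

lemma sph_mem (t : ℝ × ℝ) : sph t ∈ sphere (0 : EuclideanSpace ℝ (Fin 4)) 1 := by
  rw [mem_sphere4]
  simp [sph]
  linear_combination Real.sin_sq_add_cos_sq t.1 +
    Real.cos t.1 ^ 2 * Real.sin_sq_add_cos_sq t.2

lemma sph_odd (a b : ℝ) : sph (-a, b + Real.pi) = - sph (a, b) := by
  ext i
  fin_cases i <;> simp [sph]

lemma sph_pole (b : ℝ) : sph (Real.pi / 2, b) = sph (Real.pi / 2, 0) := by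
  ext i
  fin_cases i <;> simp [sph]

lemma fS_sph (t : ℝ × ℝ) : fS (sph t) ≤ 0 := by
  have : 3 / 5 * (sph t) 0 + 4 / 5 * (sph t) 2 = 0 := by simp [sph]; ring
  rw [fS, this]
  have := norm_nonneg (cz1 (sph t) ^ 2 - cz2 (sph t) ^ 4)
  nlinarith

lemma significant : HomotopySignificant fP 0 := by
  rintro ⟨H, H0, H1⟩
  let XX := {x : sphere (0 : EuclideanSpace ℝ (Fin 4)) 1 // fS x ≤ 0}
  let q : XX → {x | fP x ≤ 0} := fun x => ⟨pr x.1, x.2⟩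
  have hq : Continuous q := by
    refine Continuous.subtype_mk ?_ _
    exact isQuotientMap_pr.continuous.comp continuous_subtype_val
  let K : C(I × XX, Proj (EuclideanSpace ℝ (Fin 4))) :=
    ⟨fun t => H (q t.2, t.1), by fun_prop⟩
  have hK0 : ∀ a : XX, K (0, a) = pr ((⟨Subtype.val, continuous_subtype_val⟩ :
      C(XX, sphere (0 : EuclideanSpace ℝ (Fin 4)) 1)) a) := fun a => H0 (q a)
  let G := isCoveringMap_pr.liftHomotopy K _ hK0
  have hGl : ∀ t, pr (G t) = K t := congr_fun (isCoveringMap_pr.liftHomotopy_lifts K _ hK0)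
  have hG0 : ∀ a, G (0, a) = a.1 := isCoveringMap_pr.liftHomotopy_zero K _ hK0
  let ng : XX → XX := fun x => ⟨-x.1, by
    have := x.2
    rw [← fS_neg] at this
    exact this⟩
  have hng : Continuous ng := by
    refine Continuous.subtype_mk ?_ _
    fun_prop
  have hqn : ∀ x, q (ng x) = q x := fun x => by
    apply Subtype.ext
    exact (pr_eq_iff _ _).2 (Or.inr rfl)
  have hodd : ∀ t a, G (t, ng a) = - G (t, a) := by
    have : (fun ta : I × XX => - G (ta.1, ng ta.2)) = G := by
      refine (isCoveringMap_pr.eq_liftHomotopy_iff hK0 _).2 ⟨fun a => by fun_prop, ?_, fun a => ?_⟩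
      · ext ⟨t, a⟩
        have h1 : pr (- G (t, ng a)) = pr (G (t, ng a)) := (pr_eq_iff _ _).2 (Or.inr rfl)
        change pr (- G (t, ng a)) = K (t, a)
        rw [h1, hGl]
        change H (q (ng a), t) = H (q a, t)
        rw [hqn]
      · rw [hG0]
        change - - a.1 = a.1
        simp
    intro t a
    have := congr_fun this (t, a)
    rw [← this, neg_neg]
  let s : ℝ × ℝ → XX := fun t => ⟨⟨sph t, sph_mem t⟩, fS_sph t⟩
  have hs : Continuous s := (continuous_sph.subtype_mk _).subtype_mk _
  have hsodd : ∀ a b, s (-a, b + Real.pi) = ng (s (a, b)) := fun a b => by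
    apply Subtype.ext; apply Subtype.ext
    exact sph_odd a b
  have hsp : ∀ b, s (Real.pi / 2, b) = s (Real.pi / 2, 0) := fun b => by
    apply Subtype.ext; apply Subtype.ext
    exact sph_pole b
  have c1 := continuous_cz1
  have c2 := continuous_cz2
  refine no_odd_rect (fun t => cz1 (G (1, s t))) (fun t => cz2 (G (1, s t))) (by fun_prop)
    (by fun_prop) (fun a b => ?_) (fun a b => ?_) (fun b => ?_) (fun b => ?_) (fun x hx => ?_)
  · rw [hsodd, hodd, ← cz1_neg]; rfl
  · rw [hsodd, hodd, ← cz2_neg]; rfl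
  · simp only [hsp]
  · simp only [hsp]
  · have h1 : fP (pr (G (1, s x))) < 0 := by
      rw [hGl]; exact H1 (q (s x))
    rw [fP_pr, fS] at h1
    have h2 : cz1 (G (1, s x)) ^ 2 - cz2 (G (1, s x)) ^ 4 = 0 := by
      linear_combination (cz1 (G (1, s x)) + cz2 (G (1, s x)) ^ 2) * hx
    rw [h2, norm_zero] at h1
    nlinarith [sq_nonneg (3 / 5 * (G (1, s x) : EuclideanSpace ℝ (Fin 4)) 0 +
      4 / 5 * (G (1, s x) : EuclideanSpace ℝ (Fin 4)) 2)]

/-- The immersed Klein bottle. -/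
def kl (t : ℝ × ℝ) : EuclideanSpace ℝ (Fin 4) :=
  !₂[-(Real.sin (2 * t.2) * Real.sin t.1), Real.cos (2 * t.2) * Real.sin t.1,
    Real.cos t.2 * Real.cos t.1, Real.sin t.2 * Real.cos t.1]

lemma continuous_kl : Continuous kl := by
  unfold kl
  refine (PiLp.continuous_toLp 2 _).comp (continuous_pi fun i => ?_)
  fin_cases i <;> simp <;> fun_prop

lemma kl_mem (t : ℝ × ℝ) : kl t ∈ sphere (0 : EuclideanSpace ℝ (Fin 4)) 1 := by
  rw [mem_sphere4]
  simp [kl]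
  linear_combination Real.sin_sq_add_cos_sq t.1 +
    Real.cos t.1 ^ 2 * Real.sin_sq_add_cos_sq t.2 +
    Real.sin t.1 ^ 2 * Real.sin_sq_add_cos_sq (2 * t.2)

lemma kl_side (b : ℝ) : kl (Real.pi / 2, b) = - kl (-(Real.pi / 2), b) := by
  ext i
  fin_cases i <;> simp [kl]

lemma kl_row (a : ℝ) : kl (a, Real.pi) = - kl (-a, 0) := by
  ext i
  fin_cases i <;> simp [kl]

lemma fS_kl (t : ℝ × ℝ) : fS (kl t) ≤ -(1 / 4) := by
  have h1 : cz1 (kl t) ^ 2 - cz2 (kl t) ^ 4 =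
      -((Real.sin t.1 ^ 2 + Real.cos t.1 ^ 4 : ℝ) : ℂ) *
        Complex.exp ((4 * t.2 : ℝ) * Complex.I) := by
    have e1 : cz1 (kl t) = Complex.I * Complex.exp ((t.2 : ℂ) * Complex.I) ^ 2 *
        (Real.sin t.1 : ℂ) := by
      rw [← Complex.exp_nat_mul]
      have : ((2 : ℕ) : ℂ) * ((t.2 : ℂ) * Complex.I) = ((2 * t.2 : ℝ) : ℂ) * Complex.I := by
        push_cast; ring
      rw [this, Complex.exp_mul_I, ← Complex.ofReal_cos, ← Complex.ofReal_sin]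
      simp only [cz1, kl, PiLp.toLp_apply, Matrix.cons_val_zero, Matrix.cons_val_one]
      push_cast
      linear_combination -(Complex.sin (2 * t.2) * Complex.sin t.1) * Complex.I_sq
    have e2 : cz2 (kl t) = Complex.exp ((t.2 : ℂ) * Complex.I) * (Real.cos t.1 : ℂ) := by
      rw [Complex.exp_mul_I, ← Complex.ofReal_cos, ← Complex.ofReal_sin]
      simp [cz2, kl]; ring
    have e3 : Complex.exp ((4 * t.2 : ℝ) * Complex.I) =
        Complex.exp ((t.2 : ℂ) * Complex.I) ^ 4 := by
      rw [← Complex.exp_nat_mul]; congr 1; push_cast; ring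
    rw [e1, e2, e3]
    push_cast
    linear_combination (Complex.exp ((t.2 : ℂ) * Complex.I) ^ 4 * (Complex.sin t.1) ^ 2) *
      Complex.I_sq
  have h2 := (mem_sphere4 _).1 (kl_mem t)
  rw [fS, h1, norm_mul, Complex.norm_exp_ofReal_mul_I, norm_neg, Complex.norm_real,
    Real.norm_eq_abs, abs_of_nonneg (by positivity)]
  have h3 := Real.sin_sq_add_cos_sq t.1
  have h4 : (3 / 5 * (kl t) 0 + 4 / 5 * (kl t) 2) ^ 2 ≤ 1 := by
    nlinarith [sq_nonneg (4 / 5 * (kl t) 0 - 3 / 5 * (kl t) 2), sq_nonneg ((kl t) 1),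
      sq_nonneg ((kl t) 3)]
  nlinarith [sq_nonneg (Real.cos t.1 ^ 2 - 1 / 2)]

lemma genus_ge (A : Set (EuclideanSpace ℝ (Fin 4))) (hA : ∀ t, kl t ∈ A) (k : ℕ) (hk : k ≤ 3) :
    (k : ℕ∞) ≤ genus A := by
  have hne : A ≠ ∅ := Set.Nonempty.ne_empty ⟨_, hA (0, 0)⟩
  rw [genus, if_neg hne]
  refine le_sInf ?_
  rintro _ ⟨m, rfl, h, hc, h0, hodd⟩
  by_contra hlt
  have hm : m ≤ 2 := by
    have : m < k := by exact_mod_cast not_le.1 hlt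
    omega
  let e : (Fin m → ℝ) → ℂ := fun v =>
    ((if h : 0 < m then v ⟨0, h⟩ else 0 : ℝ) : ℂ) +
      ((if h : 1 < m then v ⟨1, h⟩ else 0 : ℝ) : ℂ) * Complex.I
  have he : Continuous e := by
    by_cases h0 : 0 < m <;> by_cases h1 : 1 < m <;> simp only [e, h0, h1, dif_pos, dif_neg,
      not_false_eq_true] <;> fun_prop
  have heneg : ∀ v, e (-v) = - e v := by
    intro v
    by_cases h0 : 0 < m <;> by_cases h1 : 1 < m <;> simp [e, h0, h1] <;> ring
  have he0 : ∀ v, e v = 0 → v = 0 := by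
    intro v hv
    have hre := congrArg Complex.re hv
    have him := congrArg Complex.im hv
    simp [e] at hre him
    ext ⟨i, hi⟩
    have : i = 0 ∨ i = 1 := by omega
    rcases this with rfl | rfl
    · simpa using hre hi
    · simpa using him hi
  have hneg : ∀ x y : A, (x : EuclideanSpace ℝ (Fin 4)) = -(y : EuclideanSpace ℝ (Fin 4)) →
      h x = - h y := by
    intro x y hxy
    have hx : -(y : EuclideanSpace ℝ (Fin 4)) ∈ A := hxy ▸ x.2
    rw [← hodd y hx]
    congr 1
    exact Subtype.ext hxy
  have hkl : Continuous (fun t => (⟨kl t, hA t⟩ : A)) := continuous_kl.subtype_mk _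
  refine no_odd_klein (fun t => e (h ⟨kl t, hA t⟩)) (he.comp (hc.comp hkl))
    (fun x hx => h0 _ (he0 _ hx)) (fun b => ?_) (fun a => ?_)
  · rw [← heneg]
    congr 1
    exact hneg _ _ (kl_side b)
  · rw [← heneg]
    congr 1
    exact hneg _ _ (kl_row a)

/-- The special point. -/
def pt : EuclideanSpace ℝ (Fin 4) := !₂[3 / 5, 0, 4 / 5, 0]

lemma pt_mem : pt ∈ sphere (0 : EuclideanSpace ℝ (Fin 4)) 1 := by
  rw [mem_sphere4]; simp [pt]; norm_num

lemma fS_pt : 0 < fS pt := by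
  have : cz1 pt ^ 2 - cz2 pt ^ 4 = ((-31 / 625 : ℝ) : ℂ) := by
    simp [cz1, cz2, pt]; norm_num
  rw [fS, this, Complex.norm_real]
  simp [pt]
  norm_num

lemma pt_mem_of_genus (A : Set (EuclideanSpace ℝ (Fin 4)))
    (hA : A ⊆ sphere (0 : EuclideanSpace ℝ (Fin 4)) 1)
    (hs : A = -A) (hg : ((4 : ℕ) : ℕ∞) ≤ genus A) : pt ∈ A := by
  by_contra hpt
  have hpt' : -pt ∉ A := fun h => hpt (by rw [hs]; exact h)
  have hne : A ≠ ∅ := by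
    rintro rfl
    simp [genus] at hg
  rw [genus, if_neg hne] at hg
  have : HasOddMap A 3 := by
    refine ⟨fun x => ![x.1 1, x.1 3, 4 / 5 * x.1 0 - 3 / 5 * x.1 2], ?_, ?_, ?_⟩
    · refine continuous_pi fun i => ?_
      fin_cases i <;> simp <;> fun_prop
    · intro x hx
      have h0 : x.1 1 = 0 := by simpa using congr_fun hx 0
      have h1 : x.1 3 = 0 := by simpa using congr_fun hx 1
      have h2 : 4 / 5 * x.1 0 - 3 / 5 * x.1 2 = 0 := by simpa using congr_fun hx 2
      have h3 := (mem_sphere4 _).1 (hA x.2)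
      rw [h0, h1] at h3
      have h4 : (x.1 2 - 4 / 5) * (x.1 2 + 4 / 5) = 0 := by
        linear_combination 16 / 25 * h3 - (4 / 5 * x.1 0 + 3 / 5 * x.1 2) * h2
      rcases mul_eq_zero.1 h4 with h | h
      · apply hpt
        have : x.1 = pt := by
          ext i
          fin_cases i <;> simp [pt] <;> linarith
        exact this ▸ x.2
      · apply hpt'
        have : x.1 = -pt := by
          ext i
          fin_cases i <;> simp [pt] <;> linarith
        exact this ▸ x.2
    · intro x hx
      ext i
      fin_cases i <;> simp
      ring
  have h3 : sInf {m : ℕ∞ | ∃ k : ℕ, m = k ∧ HasOddMap A k} ≤ ((3 : ℕ) : ℕ∞) :=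
    sInf_le ⟨3, rfl, this⟩
  have h := hg.trans h3
  exact absurd (Nat.cast_le.1 h) (by decide)

/-- There is a continuous function on `ℝP³` whose homotopy significant spectrum is
strictly larger than its Krasnoselskii spectrum: some homotopy significant eigenvalue `r`
differs from all the Krasnoselskii eigenvalues `kr_k`, `k = 1, …, 4`. -/
theorem exists_homotopySignificant_not_krasnoselskii :
    ∃ f : Proj (EuclideanSpace ℝ (Fin 4)) → ℝ, Continuous f ∧
      ∃ r : ℝ, HomotopySignificant f r ∧
        ∀ F : EuclideanSpace ℝ (Fin 4) → ℝ,
          (∀ x (hx : x ∈ sphere (0 : EuclideanSpace ℝ (Fin 4)) 1),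
            F x = f (Quotient.mk (projSetoid (EuclideanSpace ℝ (Fin 4))) ⟨x, hx⟩)) →
          ∀ k : ℕ, 1 ≤ k → k ≤ 4 → (r : EReal) ≠ kr F k := by
  refine ⟨fP, continuous_fP, 0, significant, fun F hF k hk1 hk4 => ?_⟩
  have hF' : ∀ x ∈ sphere (0 : EuclideanSpace ℝ (Fin 4)) 1, F x = fS x := fun x hx => hF x hx
  rcases Nat.lt_or_ge k 4 with hk | hk
  · apply ne_of_gt
    have h1 : kr F k ≤ ((-(1 / 4) : ℝ) : EReal) := by
      refine iInf₂_le_of_le (sphere (0 : EuclideanSpace ℝ (Fin 4)) 1 ∩ {x | fS x ≤ -(1 / 4)})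
        ⟨inter_subset_left, ?_, ?_, ?_⟩ ?_
      · exact isClosed_sphere.inter (isClosed_le continuous_fS continuous_const)
      · ext x
        simp [fS_neg]
      · exact genus_ge (sphere (0 : EuclideanSpace ℝ (Fin 4)) 1 ∩ {x | fS x ≤ -(1 / 4)})
          (fun t => ⟨kl_mem t, fS_kl t⟩) k (by omega)
      · refine iSup₂_le fun x hx => ?_
        rw [hF' x hx.1]
        exact EReal.coe_le_coe_iff.2 hx.2
    refine h1.trans_lt ?_
    exact EReal.coe_lt_coe_iff.2 (by norm_num)
  · obtain rfl : k = 4 := le_antisymm hk4 hk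
    apply ne_of_lt
    have h1 : ((fS pt : ℝ) : EReal) ≤ kr F 4 := by
      refine le_iInf₂ fun A hA => ?_
      obtain ⟨hA1, -, hA3, hA4⟩ := hA
      have hp := pt_mem_of_genus A hA1 hA3 hA4
      rw [← hF' pt pt_mem]
      exact le_iSup₂_of_le pt hp le_rfl
    refine lt_of_lt_of_le ?_ h1
    exact EReal.coe_lt_coe_iff.2 fS_pt

end
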